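/- Let (𝒜, W_𝒜) be a pair consisting of a bicategory and a class of morphisms satisfying conditions (BF), let ℬ be a bicategory, and let F: 𝒜 → ℬ be a pseudofunctor that sends every morphism of W_𝒜 to an internal equivalence of ℬ and satisfies conditions (EF1), (EF2) and (EF3). Then F satisfies condition (B2): for every pair of objects A¹_𝒜, A²_𝒜 of 𝒜 and every internal equivalence e: F₀(A¹_𝒜) → F₀(A²_𝒜), there exist an object A³_𝒜, morphisms u¹: A³_𝒜 → A¹_𝒜 in W_𝒜 and u²: A³_𝒜 → A²_𝒜 in (W_𝒜)_sat, an internal equivalence e': F₀(A¹_𝒜) → F₀(A³_𝒜) and invertible 2-morphisms δ¹: F₁(u¹) ∘ e' ⇒ id_{F₀(A¹_𝒜)} and δ²: e ⇒ F₁(u²) ∘ e'. -/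

import Mathlib

open CategoryTheory Bicategory

/-- A class of 1-morphisms in a bicategory. -/
abbrev MorphClass (C : Type*) [Bicategory C] :=
  ∀ ⦃a b : C⦄, (a ⟶ b) → Prop

/-- An internal equivalence in a bicategory: a morphism `e : a ⟶ b` admitting a
morphism `e' : b ⟶ a` and invertible 2-morphisms `id_a ⇒ e' ∘ e` and `e ∘ e' ⇒ id_b`. -/
def IsInternalEquiv {C : Type*} [Bicategory C] {a b : C} (e : a ⟶ b) : Prop :=
  ∃ e' : b ⟶ a, Nonempty (𝟙 a ≅ e ≫ e') ∧ Nonempty (e' ≫ e ≅ 𝟙 b)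

/-- The class of quasi-units of a bicategory: morphisms `f : a ⟶ a` admitting an
invertible 2-morphism `f ⇒ id_a`. -/
def QuasiUnits (C : Type*) [Bicategory C] : MorphClass C :=
  fun a b f => ∃ h : b = a, Nonempty (cast (congrArg (fun x => a ⟶ x) h) f ≅ 𝟙 a)

/-- The right saturation of a class of morphisms `W`: all `f : b ⟶ a` such that
there are `g : c ⟶ b` and `h : d ⟶ c` with both `f ∘ g` and `g ∘ h` in `W`. -/
def RightSat {C : Type*} [Bicategory C] (W : MorphClass C) : MorphClass C :=
  fun b a f => ∃ (c d : C) (g : c ⟶ b) (h : d ⟶ c), W (g ≫ f) ∧ W (h ≫ g)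

/-- Conditions (BF) for a pair consisting of a bicategory and a class of morphisms. -/
structure SatisfiesBF (C : Type*) [Bicategory C] (W : MorphClass C) : Prop where
  /-- (BF1): identities belong to `W`. -/
  bf1 : ∀ c : C, W (𝟙 c)
  /-- (BF2): `W` is closed under composition. -/
  bf2 : ∀ ⦃a b c : C⦄ (f : a ⟶ b) (g : b ⟶ c), W f → W g → W (f ≫ g)
  /-- (BF3) -/
  bf3 : ∀ ⦃a b c : C⦄ (w : a ⟶ b) (f : c ⟶ b), W w →
    ∃ (d : C) (v : d ⟶ c) (g : d ⟶ a), W v ∧ Nonempty (v ≫ f ≅ g ≫ w)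
  /-- (BF4) -/
  bf4 : ∀ ⦃a b c : C⦄ (w : b ⟶ a) (f₁ f₂ : c ⟶ b), W w →
    ∀ α : f₁ ≫ w ⟶ f₂ ≫ w,
    (∃ (d : C) (v : d ⟶ c) (β : v ≫ f₁ ⟶ v ≫ f₂), W v ∧
      v ◁ α = (α_ v f₁ w).inv ≫ β ▷ w ≫ (α_ v f₂ w).hom ∧
      (IsIso α → IsIso β)) ∧
    (∀ (d d' : C) (v : d ⟶ c) (v' : d' ⟶ c)
      (β : v ≫ f₁ ⟶ v ≫ f₂) (β' : v' ≫ f₁ ⟶ v' ≫ f₂),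
      W v → W v' →
      v ◁ α = (α_ v f₁ w).inv ≫ β ▷ w ≫ (α_ v f₂ w).hom →
      v' ◁ α = (α_ v' f₁ w).inv ≫ β' ▷ w ≫ (α_ v' f₂ w).hom →
      ∃ (e : C) (u : e ⟶ d) (u' : e ⟶ d'), W (u ≫ v) ∧
        ∃ ζ : u ≫ v ≅ u' ≫ v',
          (α_ u v f₁).inv ≫ ζ.hom ▷ f₁ ≫ (α_ u' v' f₁).hom ≫ u' ◁ β' =
            u ◁ β ≫ (α_ u v f₂).inv ≫ ζ.hom ▷ f₂ ≫ (α_ u' v' f₂).hom)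
  /-- (BF5): `W` is closed under invertible 2-morphisms. -/
  bf5 : ∀ ⦃a b : C⦄ (v w : a ⟶ b), W v → Nonempty (v ≅ w) → W w

theorem IsInternalEquiv.comp {C : Type*} [Bicategory C] {a b c : C} {f : a ⟶ b} {g : b ⟶ c}
    (hf : IsInternalEquiv f) (hg : IsInternalEquiv g) : IsInternalEquiv (f ≫ g) := by
  obtain ⟨f', ⟨f₁⟩, ⟨f₂⟩⟩ := hf
  obtain ⟨g', ⟨g₁⟩, ⟨g₂⟩⟩ := hg
  refine ⟨g' ≫ f', ⟨?_⟩, ⟨?_⟩⟩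
  · exact f₁ ≪≫ whiskerLeftIso f ((λ_ f').symm ≪≫ whiskerRightIso g₁ f' ≪≫ α_ g g' f') ≪≫
      (α_ f g (g' ≫ f')).symm
  · exact α_ g' f' (f ≫ g) ≪≫ whiskerLeftIso g' ((α_ f' f g).symm ≪≫ whiskerRightIso f₂ g ≪≫
      λ_ g) ≪≫ g₂

theorem IsInternalEquiv.of_iso {C : Type*} [Bicategory C] {a b : C} {f g : a ⟶ b}
    (hf : IsInternalEquiv f) (i : f ≅ g) : IsInternalEquiv g := by
  obtain ⟨f', ⟨f₁⟩, ⟨f₂⟩⟩ := hf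
  exact ⟨f', ⟨f₁ ≪≫ whiskerRightIso i f'⟩, ⟨whiskerLeftIso f' i.symm ≪≫ f₂⟩⟩

/-- A pseudofunctor that is bijective on 2-morphisms reflects isomorphism of 1-morphisms. -/
theorem nonempty_iso_of_map_iso {A : Type*} {B : Type*} [Bicategory A] [Bicategory B]
    (F : Pseudofunctor A B)
    (hF : ∀ ⦃a b : A⦄ (f₁ f₂ : a ⟶ b) (α : F.map f₁ ⟶ F.map f₂),
      ∃! β : f₁ ⟶ f₂, F.map₂ β = α)
    {a b : A} {f g : a ⟶ b} (i : F.map f ≅ F.map g) : Nonempty (f ≅ g) := by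
  obtain ⟨φ, hφ, -⟩ := hF f g i.hom
  obtain ⟨ψ, hψ, -⟩ := hF g f i.inv
  refine ⟨⟨φ, ψ, ?_, ?_⟩⟩
  · exact (hF f f (𝟙 _)).unique (by simp [hφ, hψ]) (by simp)
  · exact (hF g g (𝟙 _)).unique (by simp [hφ, hψ]) (by simp)

/-- A morphism sent to an internal equivalence can be precomposed, with another such morphism,
to a morphism of `W`. -/
theorem exists_comp_mem_of_isInternalEquiv_map {A : Type*} {B : Type*} [Bicategory A]
    [Bicategory B] {W : MorphClass A} (hW : SatisfiesBF A W) (F : Pseudofunctor A B)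
    (hF : ∀ ⦃a b : A⦄ (w : a ⟶ b), W w → IsInternalEquiv (F.map w))
    (hF₁ : ∀ (a b : A) (f : F.obj a ⟶ F.obj b), ∃ (a' : A) (g : a' ⟶ b) (w : a' ⟶ a),
      W w ∧ Nonempty (F.map g ≅ F.map w ≫ f))
    (hF₂ : ∀ ⦃a b : A⦄ (f₁ f₂ : a ⟶ b) (α : F.map f₁ ⟶ F.map f₂),
      ∃! β : f₁ ⟶ f₂, F.map₂ β = α)
    {a b : A} {u : a ⟶ b} (hu : IsInternalEquiv (F.map u)) :
    ∃ (c : A) (g : c ⟶ a), IsInternalEquiv (F.map g) ∧ W (g ≫ u) := by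
  obtain ⟨q, ⟨i₁⟩, ⟨i₂⟩⟩ := hu
  obtain ⟨c, g, w, hw, ⟨j⟩⟩ := hF₁ b a q
  have hq : IsInternalEquiv q := ⟨F.map u, ⟨i₂.symm⟩, ⟨i₁.symm⟩⟩
  refine ⟨c, g, ((hF w hw).comp hq).of_iso j.symm, ?_⟩
  exact hW.bf5 w _ hw (nonempty_iso_of_map_iso F hF₂
    ((ρ_ (F.map w)).symm ≪≫ whiskerLeftIso (F.map w) i₂.symm ≪≫
      (α_ (F.map w) q (F.map u)).symm ≪≫ whiskerRightIso j.symm (F.map u) ≪≫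
      (F.mapComp g u).symm))

/-- a pseudofunctor sending `W_𝒜` to internal equivalences and satisfying
(EF1), (EF2), (EF3) satisfies condition (B2). -/
theorem statement10 {A : Type*} {B : Type*} [Bicategory A] [Bicategory B]
    (WA : MorphClass A) (hWA : SatisfiesBF A WA)
    (F : Pseudofunctor A B)
    (hF : ∀ ⦃a b : A⦄ (w : a ⟶ b), WA w → IsInternalEquiv (F.map w))
    (hEF1 : ∀ Ab : B, ∃ (Aa : A) (t : F.obj Aa ⟶ Ab) (t' : Ab ⟶ F.obj Aa),
      t ≫ t' = 𝟙 (F.obj Aa) ∧ t' ≫ t = 𝟙 Ab)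
    (hEF2 : ∀ (Aa Ba : A) (f : F.obj Aa ⟶ F.obj Ba),
      ∃ (A'a : A) (fa : A'a ⟶ Ba) (w : A'a ⟶ Aa),
        WA w ∧ Nonempty (F.map fa ≅ F.map w ≫ f))
    (hEF3 : ∀ ⦃Aa Ba : A⦄ (f₁ f₂ : Aa ⟶ Ba) (α : F.map f₁ ⟶ F.map f₂),
      ∃! αa : f₁ ⟶ f₂, F.map₂ αa = α) :
    ∀ (A1 A2 : A) (e : F.obj A1 ⟶ F.obj A2), IsInternalEquiv e →
      ∃ (A3 : A) (u₁ : A3 ⟶ A1) (u₂ : A3 ⟶ A2) (e' : F.obj A1 ⟶ F.obj A3),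
        WA u₁ ∧ RightSat WA u₂ ∧ IsInternalEquiv e' ∧
        Nonempty (e' ≫ F.map u₁ ≅ 𝟙 (F.obj A1)) ∧
        Nonempty (e ≅ e' ≫ F.map u₂) := by
  intro A1 A2 e he
  obtain ⟨A3, u₂, u₁, hu₁, ⟨i⟩⟩ := hEF2 A1 A2 e
  obtain ⟨e', ⟨j₁⟩, ⟨j₂⟩⟩ := hF u₁ hu₁
  have hu₂ : IsInternalEquiv (F.map u₂) := ((hF u₁ hu₁).comp he).of_iso i.symm
  obtain ⟨c, g, hg, hgu⟩ := exists_comp_mem_of_isInternalEquiv_map hWA F hF hEF2 hEF3 hu₂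
  obtain ⟨d, h, -, hhg⟩ := exists_comp_mem_of_isInternalEquiv_map hWA F hF hEF2 hEF3 hg
  refine ⟨A3, u₁, u₂, e', hu₁, ⟨c, d, g, h, hgu, hhg⟩,
    ⟨F.map u₁, ⟨j₂.symm⟩, ⟨j₁.symm⟩⟩, ⟨j₂⟩, ⟨?_⟩⟩
  exact (λ_ e).symm ≪≫ whiskerRightIso j₂.symm e ≪≫ α_ e' (F.map u₁) e ≪≫
    whiskerLeftIso e' i.symm
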